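/- arXiv:1305.6080 — 2 statements merged into one kernel-verified Lean document; each statement's English description precedes it below -/
import Mathlib

section
/- For any set Σ of 𝓛-sentences, the data (universe ℕ, standard interpretations of 0, S, +, ·, and the rule 'Kφ is satisfied at assignment s iff Σ ⊨ φ^s') really constitutes an 𝓛-structure M_Σ: it satisfies conditions (a) irrelevance of assignments to non-free variables, (b) invariance under alphabetic variants, and (c) weak substitution. -/
/-!
Formalization of the framework of "A machine that knows its own code" (S. Alexander).

The language 𝓛 is the language of Peano arithmetic (constant `0`, unary successor `S`,
binary `+` and `·`) extended by a unary modal operator `K`.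
-/

/-- Terms of the language 𝓛 of Peano arithmetic (variables are indexed by `ℕ`). -/
inductive LTerm : Type
  | var : ℕ → LTerm
  | zero : LTerm
  | succ : LTerm → LTerm
  | add : LTerm → LTerm → LTerm
  | mul : LTerm → LTerm → LTerm
  deriving DecidableEq

/-- Formulas of 𝓛: atomic equalities, falsum, implication, universal quantification,
and the modal operator `K`.  Other connectives and `∃` are defined below. -/
inductive LFormula : Type
  | eq : LTerm → LTerm → LFormula
  | falsum : LFormula
  | imp : LFormula → LFormula → LFormula
  | all : ℕ → LFormula → LFormula
  | K : LFormula → LFormula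
  deriving DecidableEq

namespace LTerm

/-- Variables occurring in a term. -/
def fv : LTerm → Finset ℕ
  | var n => {n}
  | zero => ∅
  | succ t => t.fv
  | add t u => t.fv ∪ u.fv
  | mul t u => t.fv ∪ u.fv

/-- Simultaneous substitution of terms for variables in a term. -/
def subst (s : ℕ → LTerm) : LTerm → LTerm
  | var n => s n
  | zero => zero
  | succ t => succ (t.subst s)
  | add t u => add (t.subst s) (u.subst s)
  | mul t u => mul (t.subst s) (u.subst s)

end LTerm

/-- The numeral `n̄` for a natural number `n`. -/
def numeral : ℕ → LTerm
  | 0 => LTerm.zero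
  | n + 1 => LTerm.succ (numeral n)

namespace LFormula

/-- The free variables of a formula (the free variables of `K φ` are those of `φ`). -/
def fv : LFormula → Finset ℕ
  | eq t u => t.fv ∪ u.fv
  | falsum => ∅
  | imp a b => a.fv ∪ b.fv
  | all x a => a.fv.erase x
  | K a => a.fv

/-- Simultaneous substitution of terms for the *free* variables of a formula
(bound variables are left untouched; the substitution is not capture-avoiding). -/
def subst (s : ℕ → LTerm) : LFormula → LFormula
  | eq t u => eq (t.subst s) (u.subst s)
  | falsum => falsum
  | imp a b => imp (a.subst s) (b.subst s)
  | all x a => all x (a.subst fun z => if z = x then LTerm.var x else s z)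
  | K a => K (a.subst s)

end LFormula

/-- `subst1 x t φ` is `φ(x|t)`, the result of substituting the term `t` for the free
occurrences of the variable `x` in `φ`. -/
def subst1 (x : ℕ) (t : LTerm) (φ : LFormula) : LFormula :=
  φ.subst fun z => if z = x then t else LTerm.var z

/-- `instNum s φ` is `φ^s`: the sentence obtained from `φ` by replacing each free
variable `x` of `φ` by the numeral for `s x`. -/
def instNum (s : ℕ → ℕ) (φ : LFormula) : LFormula :=
  φ.subst fun z => numeral (s z)

/-- `SubstitutableVar y x φ`: the variable `y` is substitutable for the variable `x`
in `φ` (no free occurrence of `x` lies within the scope of a quantifier binding `y`). -/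
def SubstitutableVar (y x : ℕ) : LFormula → Prop
  | .eq _ _ => True
  | .falsum => True
  | .imp a b => SubstitutableVar y x a ∧ SubstitutableVar y x b
  | .all z a => x ∉ (LFormula.all z a).fv ∨ (y ≠ z ∧ SubstitutableVar y x a)
  | .K a => SubstitutableVar y x a

/-- Correspondence of variables relative to a list of pairs of bound variables. -/
def VarCorr : List (ℕ × ℕ) → ℕ → ℕ → Prop
  | [], x, y => x = y
  | (a, b) :: Γ, x, y => (x = a ∧ y = b) ∨ (x ≠ a ∧ y ≠ b ∧ VarCorr Γ x y)

/-- Alpha-correspondence of terms relative to a list of pairs of bound variables. -/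
def TermAlpha (Γ : List (ℕ × ℕ)) : LTerm → LTerm → Prop
  | .var x, .var y => VarCorr Γ x y
  | .zero, .zero => True
  | .succ t, .succ u => TermAlpha Γ t u
  | .add t₁ t₂, .add u₁ u₂ => TermAlpha Γ t₁ u₁ ∧ TermAlpha Γ t₂ u₂
  | .mul t₁ t₂, .mul u₁ u₂ => TermAlpha Γ t₁ u₁ ∧ TermAlpha Γ t₂ u₂
  | _, _ => False

/-- Alpha-correspondence of formulas relative to a list of pairs of bound variables. -/
def FormulaAlpha : List (ℕ × ℕ) → LFormula → LFormula → Prop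
  | Γ, .eq t₁ t₂, .eq u₁ u₂ => TermAlpha Γ t₁ u₁ ∧ TermAlpha Γ t₂ u₂
  | _, .falsum, .falsum => True
  | Γ, .imp a₁ a₂, .imp b₁ b₂ => FormulaAlpha Γ a₁ b₁ ∧ FormulaAlpha Γ a₂ b₂
  | Γ, .all x a, .all y b => FormulaAlpha ((x, y) :: Γ) a b
  | Γ, .K a, .K b => FormulaAlpha Γ a b
  | _, _, _ => False

/-- `ψ` is an alphabetic variant of `φ`: `ψ` is obtained from `φ` by renaming bound
variables so as to respect the binding of the quantifiers. -/
def AlphaVariant (φ ψ : LFormula) : Prop := FormulaAlpha [] φ ψ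

/-- Negation, defined from `→` and `⊥`. -/
def notF (φ : LFormula) : LFormula := LFormula.imp φ LFormula.falsum

/-- Conjunction (defined connective). -/
def andF (φ ψ : LFormula) : LFormula := notF (LFormula.imp φ (notF ψ))

/-- Biconditional (defined connective). -/
def iffF (φ ψ : LFormula) : LFormula := andF (LFormula.imp φ ψ) (LFormula.imp ψ φ)

/-- Existential quantification (defined). -/
def exF (x : ℕ) (φ : LFormula) : LFormula := notF (LFormula.all x (notF φ))

/-- A canonical universal closure of a formula. -/
def uclose (φ : LFormula) : LFormula :=
  (φ.fv.sort (· ≤ ·)).foldr LFormula.all φ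

/-- An 𝓛-structure: a first-order structure for the first-order part of 𝓛, together
with a truth assignment `satK s φ` for the purely modal formulas `K φ` at each
assignment `s` into the universe (the three required constraints are singled out
in `IsLStructure` below). -/
structure LStructure where
  U : Type
  nonempty : Nonempty U
  zero : U
  succ : U → U
  add : U → U → U
  mul : U → U → U
  satK : (ℕ → U) → LFormula → Prop

namespace LStructure

/-- Value of a term under an assignment. -/
def evalT (M : LStructure) (s : ℕ → M.U) : LTerm → M.U
  | .var n => s n
  | .zero => M.zero
  | .succ t => M.succ (M.evalT s t)
  | .add t u => M.add (M.evalT s t) (M.evalT s u)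
  | .mul t u => M.mul (M.evalT s t) (M.evalT s u)

/-- Satisfaction `M ⊨ φ[s]`, defined by the usual induction on formula complexity,
with `M ⊨ (K φ)[s]` given by the structure's truth assignment `satK`. -/
def Sat (M : LStructure) : (ℕ → M.U) → LFormula → Prop
  | s, .eq t u => M.evalT s t = M.evalT s u
  | _, .falsum => False
  | s, .imp a b => M.Sat s a → M.Sat s b
  | s, .all x a => ∀ u : M.U, M.Sat (Function.update s x u) a
  | s, .K a => M.satK s a

/-- `M ⊨ φ`: `M ⊨ φ[s]` for every assignment `s`. -/
def Models (M : LStructure) (φ : LFormula) : Prop := ∀ s : ℕ → M.U, M.Sat s φ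

end LStructure

/-- The three constraints making an `LStructure` a genuine 𝓛-structure of the base
logic: (a) `satK s φ` depends only on the values of `s` on the free variables of `φ`;
(b) invariance under alphabetic variants; (c) weak substitution. -/
def IsLStructure (M : LStructure) : Prop :=
  (∀ (φ : LFormula) (s t : ℕ → M.U), (∀ x ∈ φ.fv, s x = t x) →
      (M.satK s φ ↔ M.satK t φ)) ∧
  (∀ (φ ψ : LFormula) (s : ℕ → M.U), AlphaVariant φ ψ →
      (M.satK s φ ↔ M.satK s ψ)) ∧
  (∀ (φ : LFormula) (x y : ℕ) (s : ℕ → M.U), SubstitutableVar y x φ →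
      (M.satK s (subst1 x (LTerm.var y) φ) ↔ M.satK (Function.update s x (s y)) φ))

/-- `Σ ⊨ φ`: every 𝓛-structure satisfying every member of `Σ` satisfies `φ`. -/
def Consequence (T : Set LFormula) (φ : LFormula) : Prop :=
  ∀ M : LStructure, IsLStructure M → (∀ σ ∈ T, M.Models σ) → M.Models φ

/-- `φ` is valid: `∅ ⊨ φ`, i.e. `φ` holds in every 𝓛-structure under every assignment. -/
def Valid (φ : LFormula) : Prop := Consequence ∅ φ

/-- The structure `M_Σ`: universe `ℕ`, standard interpretations of the symbols of
Peano arithmetic, and `M_Σ ⊨ (K φ)[s]` iff `Σ ⊨ φ^s`. -/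
def MSigma (T : Set LFormula) : LStructure where
  U := ℕ
  nonempty := ⟨0⟩
  zero := 0
  succ := Nat.succ
  add := (· + ·)
  mul := (· * ·)
  satK := fun s φ => Consequence T (instNum s φ)

/-- Instances of the schema `E1`: the universal closure of `K φ` for valid `φ`. -/
def E1set : Set LFormula :=
  {χ | ∃ φ : LFormula, Valid φ ∧ χ = uclose (LFormula.K φ)}

/-- Instances of the schema `E2`: the universal closure of `K(φ → ψ) → K φ → K ψ`. -/
def E2set : Set LFormula :=
  {χ | ∃ φ ψ : LFormula,
    χ = uclose (LFormula.imp (LFormula.K (LFormula.imp φ ψ))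
      (LFormula.imp (LFormula.K φ) (LFormula.K ψ)))}

/-- Instances of the schema `E3` (factivity): the universal closure of `K φ → φ`. -/
def E3set : Set LFormula :=
  {χ | ∃ φ : LFormula, χ = uclose (LFormula.imp (LFormula.K φ) φ)}

/-- Instances of the schema `E4`: the universal closure of `K φ → K K φ`. -/
def E4set : Set LFormula :=
  {χ | ∃ φ : LFormula, χ = uclose (LFormula.imp (LFormula.K φ) (LFormula.K (LFormula.K φ)))}

/-- The axioms of Peano arithmetic for 𝓛: the six usual axioms for successor,
addition and multiplication, and the induction schema extended to all 𝓛-formulas. -/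
inductive PAax : LFormula → Prop
  | succ_ne_zero : PAax (.all 0 (notF (.eq (.succ (.var 0)) .zero)))
  | succ_inj : PAax (.all 0 (.all 1 (.imp (.eq (.succ (.var 0)) (.succ (.var 1)))
      (.eq (.var 0) (.var 1)))))
  | add_zero : PAax (.all 0 (.eq (.add (.var 0) .zero) (.var 0)))
  | add_succ : PAax (.all 0 (.all 1 (.eq (.add (.var 0) (.succ (.var 1)))
      (.succ (.add (.var 0) (.var 1))))))
  | mul_zero : PAax (.all 0 (.eq (.mul (.var 0) .zero) .zero))
  | mul_succ : PAax (.all 0 (.all 1 (.eq (.mul (.var 0) (.succ (.var 1)))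
      (.add (.mul (.var 0) (.var 1)) (.var 0)))))
  | ind (φ : LFormula) (x : ℕ) :
      PAax (uclose (.imp (subst1 x .zero φ)
        (.imp (.all x (.imp φ (subst1 x (.succ (.var x)) φ))) (.all x φ))))

/-- The set of axioms of Peano arithmetic for 𝓛. -/
def PAset : Set LFormula := {φ | PAax φ}

/-- `W e`: the `e`-th recursively enumerable subset of `ℕ` (the domain of the `e`-th
partial computable function). -/
def W (e : ℕ) : Set ℕ :=
  {m | ((Denumerable.ofNat Nat.Partrec.Code e).eval m).Dom}

namespace LTerm

/-- A canonical Gödel numbering of terms. -/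
def gnum : LTerm → ℕ
  | var n => Nat.pair 0 n
  | zero => Nat.pair 1 0
  | succ t => Nat.pair 2 t.gnum
  | add t u => Nat.pair 3 (Nat.pair t.gnum u.gnum)
  | mul t u => Nat.pair 4 (Nat.pair t.gnum u.gnum)

end LTerm

namespace LFormula

/-- A canonical Gödel numbering `⌜φ⌝` of formulas. -/
def gnum : LFormula → ℕ
  | eq t u => Nat.pair 0 (Nat.pair t.gnum u.gnum)
  | falsum => Nat.pair 1 0
  | imp a b => Nat.pair 2 (Nat.pair a.gnum b.gnum)
  | all x a => Nat.pair 3 (Nat.pair x a.gnum)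
  | K a => Nat.pair 4 a.gnum

end LFormula

/-- The designated variable `x`. -/
def vx : ℕ := 0
/-- The designated variable `y` (second pairing argument). -/
def vy : ℕ := 1
/-- The designated variable `e` (r.e. index). -/
def ve : ℕ := 2

/-- A formula is `K`-free (purely first-order) if the operator `K` does not occur in it. -/
def KFree : LFormula → Prop
  | .eq _ _ => True
  | .falsum => True
  | .imp a b => KFree a ∧ KFree b
  | .all _ a => KFree a
  | .K _ => False

/-- The standard structure: universe `ℕ` with the standard interpretations of the
symbols of Peano arithmetic (the modal component is irrelevant for `K`-free formulas). -/
def StdModel : LStructure where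
  U := ℕ
  nonempty := ⟨0⟩
  zero := 0
  succ := Nat.succ
  add := (· + ·)
  mul := (· * ·)
  satK := fun _ _ => False

/-- `pwNum pw a b k`: the result of substituting the numerals `ā`, `b̄`, `k̄` for the
designated variables `x`, `y`, `e` in the formula `pw` (read: `⟨ā, b̄⟩ ∈ W_k̄`). -/
def pwNum (pw : LFormula) (a b k : ℕ) : LFormula :=
  instNum (fun z => if z = vx then a else if z = vy then b else k) pw

/-- `wNum w a k`: the result of substituting the numerals `ā`, `k̄` for the designated
variables `x`, `e` in the formula `w` (read: `ā ∈ W_k̄`). -/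
def wNum (w : LFormula) (a k : ℕ) : LFormula :=
  instNum (fun z => if z = vx then a else k) w

/-- Line 3 of the definition of `Σ(n)`: the sentence
`∀x (K φ ↔ ⟨x, ⌜φ⌝⟩ ∈ W_n̄)`, where `pw` is the formula (with designated free
variables `x`, `y`, `e`) expressing `⟨x, y⟩ ∈ W_e`. -/
def line3 (pw : LFormula) (n : ℕ) (φ : LFormula) : LFormula :=
  LFormula.all vx (iffF (LFormula.K φ)
    (subst1 ve (numeral n) (subst1 vy (numeral φ.gnum) pw)))

/-- Membership in the axiom set `Σ(n)` (relative to the formula `pw` expressing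
`⟨x, y⟩ ∈ W_e`): (1) instances of `E1`, `E2`, `E4`; (2) the axioms of Peano
arithmetic for 𝓛; (3) `∀x (K φ ↔ ⟨x, ⌜φ⌝⟩ ∈ W_n̄)` for `φ` with free variables
⊆ {x}; (4) assigned validity `φ^s` for valid `φ`; (5) `K φ` for `φ` an instance of
lines 1–4 or, recursively, of line 5. -/
inductive SigmaAx (pw : LFormula) (n : ℕ) : LFormula → Prop
  | e1 {χ : LFormula} (h : χ ∈ E1set) : SigmaAx pw n χ
  | e2 {χ : LFormula} (h : χ ∈ E2set) : SigmaAx pw n χ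
  | e4 {χ : LFormula} (h : χ ∈ E4set) : SigmaAx pw n χ
  | pa {χ : LFormula} (h : PAax χ) : SigmaAx pw n χ
  | code (φ : LFormula) (h : φ.fv ⊆ {vx}) : SigmaAx pw n (line3 pw n φ)
  | av (φ : LFormula) (s : ℕ → ℕ) (h : Valid φ) : SigmaAx pw n (instNum s φ)
  | k {φ : LFormula} (h : SigmaAx pw n φ) : SigmaAx pw n (LFormula.K φ)

/-- The axiom set `Σ(n)` (relative to `pw`). -/
def SigmaN (pw : LFormula) (n : ℕ) : Set LFormula := {φ | SigmaAx pw n φ}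

/-- The set `{ ⟨m, ⌜φ⌝⟩ : φ an 𝓛-formula with free variables ⊆ {x} and
Σ(n) ⊨ φ(x|m̄) }`. -/
def goalSet (pw : LFormula) (n : ℕ) : Set ℕ :=
  {p | ∃ (m : ℕ) (φ : LFormula), p = Nat.pair m φ.gnum ∧ φ.fv ⊆ {vx} ∧
    Consequence (SigmaN pw n) (subst1 vx (numeral m) φ)}

namespace LTerm

theorem subst_congr {σ τ : ℕ → LTerm} {t : LTerm} (h : ∀ x ∈ t.fv, σ x = τ x) :
    t.subst σ = t.subst τ := by
  induction t <;> simp_all [fv, subst]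

theorem subst_var (t : LTerm) : t.subst var = t := by
  induction t <;> simp_all [subst]

theorem subst_subst (σ τ : ℕ → LTerm) (t : LTerm) :
    (t.subst σ).subst τ = t.subst fun z => (σ z).subst τ := by
  induction t <;> simp_all [subst]

theorem exists_of_mem_fv_subst {σ : ℕ → LTerm} {x : ℕ} {t : LTerm}
    (h : x ∈ (t.subst σ).fv) : ∃ u ∈ t.fv, x ∈ (σ u).fv := by
  induction t with
  | var n => exact ⟨n, by simp [fv], h⟩
  | zero => simp [subst, fv] at h
  | succ t ih => exact ih h
  | add t u iht ihu =>
    simp only [subst, fv, Finset.mem_union] at h ⊢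
    rcases h with h | h
    · obtain ⟨v, hv, hx⟩ := iht h
      exact ⟨v, .inl hv, hx⟩
    · obtain ⟨v, hv, hx⟩ := ihu h
      exact ⟨v, .inr hv, hx⟩
  | mul t u iht ihu =>
    simp only [subst, fv, Finset.mem_union] at h ⊢
    rcases h with h | h
    · obtain ⟨v, hv, hx⟩ := iht h
      exact ⟨v, .inl hv, hx⟩
    · obtain ⟨v, hv, hx⟩ := ihu h
      exact ⟨v, .inr hv, hx⟩

end LTerm

namespace LFormula

theorem subst_congr {φ : LFormula} {σ τ : ℕ → LTerm} (h : ∀ x ∈ φ.fv, σ x = τ x) :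
    φ.subst σ = φ.subst τ := by
  induction φ generalizing σ τ with
  | eq t u =>
    simp only [fv, Finset.mem_union] at h
    simp only [subst]
    rw [LTerm.subst_congr fun x hx => h x (.inl hx), LTerm.subst_congr fun x hx => h x (.inr hx)]
  | falsum => rfl
  | imp a b iha ihb =>
    simp only [fv, Finset.mem_union] at h
    simp only [subst]
    rw [iha fun x hx => h x (.inl hx), ihb fun x hx => h x (.inr hx)]
  | all x a ih =>
    simp only [subst]
    rw [ih]
    intro z hz
    split_ifs with hzx
    · rfl
    · exact h z (Finset.mem_erase.2 ⟨hzx, hz⟩)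
  | K a ih => exact congrArg K (ih h)

theorem subst_var (φ : LFormula) : φ.subst LTerm.var = φ := by
  induction φ with
  | eq t u => simp [subst, LTerm.subst_var]
  | falsum => rfl
  | imp a b iha ihb => simp [subst, iha, ihb]
  | all x a ih =>
    have h : (fun z => if z = x then LTerm.var x else LTerm.var z) = LTerm.var := by
      funext z
      split_ifs with hz
      · rw [hz]
      · rfl
    simp only [subst]
    rw [h, ih]
  | K a ih => simp [subst, ih]

theorem exists_of_mem_fv_subst {φ : LFormula} {σ : ℕ → LTerm} {x : ℕ}
    (h : x ∈ (φ.subst σ).fv) : ∃ u ∈ φ.fv, x ∈ (σ u).fv := by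
  induction φ generalizing σ with
  | eq t u =>
    simp only [subst, fv, Finset.mem_union] at h ⊢
    rcases h with h | h
    · obtain ⟨v, hv, hx⟩ := LTerm.exists_of_mem_fv_subst h
      exact ⟨v, .inl hv, hx⟩
    · obtain ⟨v, hv, hx⟩ := LTerm.exists_of_mem_fv_subst h
      exact ⟨v, .inr hv, hx⟩
  | falsum => simp [subst, fv] at h
  | imp a b iha ihb =>
    simp only [subst, fv, Finset.mem_union] at h ⊢
    rcases h with h | h
    · obtain ⟨v, hv, hx⟩ := iha h
      exact ⟨v, .inl hv, hx⟩
    · obtain ⟨v, hv, hx⟩ := ihb h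
      exact ⟨v, .inr hv, hx⟩
  | all y a ih =>
    simp only [subst, fv, Finset.mem_erase] at h ⊢
    obtain ⟨v, hv, hx⟩ := ih h.2
    split_ifs at hx with hvy
    · exact absurd (Finset.mem_singleton.1 hx) h.1
    · exact ⟨v, ⟨hvy, hv⟩, hx⟩
  | K a ih => exact ih h

/-- The variables bound by a quantifier somewhere in a formula. -/
def bv : LFormula → Finset ℕ
  | eq _ _ => ∅
  | falsum => ∅
  | imp a b => a.bv ∪ b.bv
  | all x a => insert x a.bv
  | K a => a.bv

end LFormula

theorem substitutableVar_of_notMem_bv {y x : ℕ} {φ : LFormula} (h : y ∉ φ.bv) :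
    SubstitutableVar y x φ := by
  induction φ <;> simp_all [LFormula.bv, SubstitutableVar]

theorem subst_subst1_var {φ : LFormula} {x y : ℕ} (h : SubstitutableVar y x φ)
    (ρ : ℕ → LTerm) :
    (subst1 x (LTerm.var y) φ).subst ρ = φ.subst (Function.update ρ x (ρ y)) := by
  have key (z : ℕ) : (if z = x then LTerm.var y else LTerm.var z).subst ρ =
      Function.update ρ x (ρ y) z := by
    split_ifs with hz
    · simp [hz, LTerm.subst]
    · simp [hz, LTerm.subst]
  unfold subst1
  induction φ generalizing ρ with
  | eq t u => simp only [LFormula.subst, LTerm.subst_subst, key]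
  | falsum => rfl
  | imp a b iha ihb =>
    simp only [LFormula.subst]
    rw [iha h.1 ρ key, ihb h.2 ρ key]
  | K a ih => exact congrArg LFormula.K (ih h ρ key)
  | all z a ih =>
    simp only [LFormula.subst, LFormula.all.injEq, true_and]
    by_cases hx : x ∈ (LFormula.all z a).fv
    · obtain ⟨hyz, ha⟩ := h.resolve_left (not_not.2 hx)
      have hxz : x ≠ z := (Finset.mem_erase.1 hx).1
      have e : (fun w => if w = z then LTerm.var z else
          if w = x then LTerm.var y else LTerm.var w) =
          fun w => if w = x then LTerm.var y else LTerm.var w := by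
        funext w
        by_cases hw : w = z
        · subst hw
          simp [hxz.symm]
        · simp [hw]
      rw [e, ih ha]
      · congr 1
        funext w
        by_cases hw : w = x
        · subst hw
          simp [hxz, hyz]
        · simp [hw]
      · intro w
        by_cases hw : w = x
        · simp [hw, LTerm.subst]
        · simp [hw, LTerm.subst]
    · have hne : ∀ w ∈ a.fv, w ≠ z → w ≠ x := by
        rintro w hw hwz rfl
        exact hx (Finset.mem_erase.2 ⟨hwz, hw⟩)
      have e : a.subst (fun w => if w = z then LTerm.var z else
          if w = x then LTerm.var y else LTerm.var w) = a := by
        conv_rhs => rw [← a.subst_var]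
        refine LFormula.subst_congr fun w hw => ?_
        by_cases hwz : w = z
        · simp [hwz]
        · simp [hwz, hne w hw hwz]
      rw [e]
      refine LFormula.subst_congr fun w hw => ?_
      by_cases hwz : w = z
      · simp [hwz]
      · simp [hwz, hne w hw hwz]

theorem mem_fv_subst1_var {φ : LFormula} {p z x : ℕ}
    (h : x ∈ (subst1 p (LTerm.var z) φ).fv) :
    (x = z ∧ p ∈ φ.fv) ∨ (x ≠ p ∧ x ∈ φ.fv) := by
  obtain ⟨u, hu, hx⟩ := LFormula.exists_of_mem_fv_subst h
  split_ifs at hx with hup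
  · exact .inl ⟨Finset.mem_singleton.1 hx, hup ▸ hu⟩
  · obtain rfl := Finset.mem_singleton.1 hx
    exact .inr ⟨hup, hu⟩

theorem TermAlpha.cons {Γ : List (ℕ × ℕ)} {x y : ℕ} {t u : LTerm} (h : TermAlpha Γ t u)
    (hx : x ∉ t.fv) (hy : y ∉ u.fv) : TermAlpha ((x, y) :: Γ) t u := by
  induction t generalizing u <;> cases u <;>
    simp_all [TermAlpha, VarCorr, LTerm.fv, eq_comm]

theorem TermAlpha.subst {Γ Δ : List (ℕ × ℕ)} {σ τ : ℕ → LTerm} {t u : LTerm}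
    (h : TermAlpha Γ t u) (hστ : ∀ x y, VarCorr Γ x y → TermAlpha Δ (σ x) (τ y)) :
    TermAlpha Δ (t.subst σ) (u.subst τ) := by
  induction t generalizing u <;> cases u <;> simp_all [TermAlpha, LTerm.subst]

theorem FormulaAlpha.subst {Γ Δ : List (ℕ × ℕ)} {σ τ : ℕ → LTerm} {φ ψ : LFormula}
    (h : FormulaAlpha Γ φ ψ) (hστ : ∀ x y, VarCorr Γ x y → TermAlpha Δ (σ x) (τ y))
    (hσ : ∀ u, ∀ w ∈ (σ u).fv, w = u ∨ w ∉ φ.bv)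
    (hτ : ∀ u, ∀ w ∈ (τ u).fv, w = u ∨ w ∉ ψ.bv) :
    FormulaAlpha Δ (φ.subst σ) (ψ.subst τ) := by
  induction φ generalizing Γ Δ σ τ ψ with
  | eq t u =>
    cases ψ <;> simp only [FormulaAlpha] at h
    exact ⟨h.1.subst hστ, h.2.subst hστ⟩
  | falsum =>
    cases ψ <;> simp only [FormulaAlpha] at h
    trivial
  | imp a b iha ihb =>
    cases ψ <;> simp only [FormulaAlpha] at h
    simp only [LFormula.bv, Finset.mem_union, not_or] at hσ hτ
    exact ⟨iha h.1 hστ (fun u w hw => (hσ u w hw).imp_right And.left)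
        fun u w hw => (hτ u w hw).imp_right And.left,
      ihb h.2 hστ (fun u w hw => (hσ u w hw).imp_right And.right)
        fun u w hw => (hτ u w hw).imp_right And.right⟩
  | K a ih =>
    cases ψ <;> simp only [FormulaAlpha] at h
    exact ih h hστ hσ hτ
  | all x a ih =>
    cases ψ <;> simp only [FormulaAlpha] at h
    rename_i y b
    simp only [LFormula.bv, Finset.mem_insert, not_or] at hσ hτ
    refine ih h ?_ ?_ ?_
    · rintro u v (⟨rfl, rfl⟩ | ⟨hu, hv, huv⟩)
      · simp [TermAlpha, VarCorr]
      · simp only [if_neg hu, if_neg hv]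
        refine (hστ u v huv).cons (fun hx => ?_) fun hy => ?_
        · exact (hσ u x hx).elim (fun e => hu e.symm) fun e => e.1 rfl
        · exact (hτ v y hy).elim (fun e => hv e.symm) fun e => e.1 rfl
    · intro u w hw
      split_ifs at hw with hu
      · exact .inl ((Finset.mem_singleton.1 hw).trans hu.symm)
      · exact (hσ u w hw).imp_right And.right
    · intro u w hw
      split_ifs at hw with hu
      · exact .inl ((Finset.mem_singleton.1 hw).trans hu.symm)
      · exact (hτ u w hw).imp_right And.right

theorem VarCorr.eq_iff_of_fresh {Γ : List (ℕ × ℕ)} {z x y : ℕ}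
    (hz : ∀ q ∈ Γ, z ≠ q.1 ∧ z ≠ q.2) (h : VarCorr Γ x y) : x = z ↔ y = z := by
  induction Γ with
  | nil => rw [show x = y from h]
  | cons q Γ ih =>
    obtain ⟨hq, hΓ⟩ := List.forall_mem_cons.1 hz
    rcases h with ⟨rfl, rfl⟩ | ⟨-, -, h⟩
    · exact iff_of_false hq.1.symm hq.2.symm
    · exact ih hΓ h

theorem varCorr_self_of_fresh {Γ : List (ℕ × ℕ)} {z : ℕ}
    (hz : ∀ q ∈ Γ, z ≠ q.1 ∧ z ≠ q.2) : VarCorr Γ z z := by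
  induction Γ with
  | nil => rfl
  | cons q Γ ih =>
    obtain ⟨hq, hΓ⟩ := List.forall_mem_cons.1 hz
    exact .inr ⟨hq.1, hq.2, ih hΓ⟩

theorem FormulaAlpha.subst1_fresh {Γ : List (ℕ × ℕ)} {p q z : ℕ} {φ ψ : LFormula}
    (h : FormulaAlpha ((p, q) :: Γ) φ ψ) (hz : ∀ r ∈ Γ, z ≠ r.1 ∧ z ≠ r.2)
    (hφ : z ∉ φ.bv) (hψ : z ∉ ψ.bv) :
    FormulaAlpha Γ (subst1 p (LTerm.var z) φ) (subst1 q (LTerm.var z) ψ) := by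
  refine h.subst ?_ ?_ ?_
  · rintro x y (⟨rfl, rfl⟩ | ⟨hx, hy, hxy⟩)
    · simpa [TermAlpha] using varCorr_self_of_fresh hz
    · simpa [TermAlpha, hx, hy] using hxy
  · intro u w hw
    split_ifs at hw
    · exact .inr (Finset.mem_singleton.1 hw ▸ hφ)
    · exact .inl (Finset.mem_singleton.1 hw)
  · intro u w hw
    split_ifs at hw
    · exact .inr (Finset.mem_singleton.1 hw ▸ hψ)
    · exact .inl (Finset.mem_singleton.1 hw)

theorem IsLStructure.satK_subst1_fresh {M : LStructure} (hM : IsLStructure M)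
    (φ : LFormula) {p z : ℕ} (s : ℕ → M.U) (hfv : z ∉ φ.fv) (hbv : z ∉ φ.bv) :
    M.satK (Function.update s z (s p)) (subst1 p (LTerm.var z) φ) ↔ M.satK s φ := by
  rw [hM.2.2 φ p z _ (substitutableVar_of_notMem_bv hbv)]
  refine hM.1 φ _ _ fun x hx => ?_
  have hxz : x ≠ z := fun e => hfv (e ▸ hx)
  by_cases hxp : x = p
  · simp [hxp]
  · simp [hxp, hxz]

theorem IsLStructure.satK_iff_of_formulaAlpha {M : LStructure} (hM : IsLStructure M)
    {Γ : List (ℕ × ℕ)} {φ ψ : LFormula} {s t : ℕ → M.U} (h : FormulaAlpha Γ φ ψ)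
    (hst : ∀ x ∈ φ.fv, ∀ y ∈ ψ.fv, VarCorr Γ x y → s x = t y) :
    M.satK s φ ↔ M.satK t ψ := by
  induction Γ generalizing φ ψ s t with
  | nil =>
    let r : ℕ → M.U := fun x => if x ∈ ψ.fv then t x else s x
    have hs : M.satK s φ ↔ M.satK r φ := by
      refine hM.1 φ s r fun x hx => ?_
      by_cases hxψ : x ∈ ψ.fv
      · simpa [r, hxψ] using hst x hx x hxψ rfl
      · simp [r, hxψ]
    have ht : M.satK r ψ ↔ M.satK t ψ :=
      hM.1 ψ r t fun x hx => by simp [r, hx]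
    exact hs.trans ((hM.2.1 φ ψ r h).trans ht)
  | cons a Γ ih =>
    obtain ⟨p, q⟩ := a
    obtain ⟨z, hz⟩ := Infinite.exists_notMem_finset
      (φ.fv ∪ φ.bv ∪ ψ.fv ∪ ψ.bv ∪ (Γ.map Prod.fst).toFinset ∪ (Γ.map Prod.snd).toFinset)
    simp only [Finset.mem_union, not_or, List.mem_toFinset] at hz
    obtain ⟨⟨⟨⟨⟨hφf, hφb⟩, hψf⟩, hψb⟩, hz₁⟩, hz₂⟩ := hz
    have hΓ : ∀ r ∈ Γ, z ≠ r.1 ∧ z ≠ r.2 := fun r hr =>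
      ⟨fun e => hz₁ (e ▸ List.mem_map_of_mem hr), fun e => hz₂ (e ▸ List.mem_map_of_mem hr)⟩
    rw [← hM.satK_subst1_fresh φ (p := p) s hφf hφb, ← hM.satK_subst1_fresh ψ (p := q) t hψf hψb]
    refine ih (h.subst1_fresh hΓ hφb hψb) fun x hx y hy hxy => ?_
    have hiff := hxy.eq_iff_of_fresh hΓ
    rcases mem_fv_subst1_var hx with ⟨hxz, hp⟩ | ⟨hxp, hxφ⟩
    · rcases mem_fv_subst1_var hy with ⟨hyz, hq⟩ | ⟨-, hyψ⟩
      · subst hxz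
        simpa [hyz] using hst p hp q hq (.inl ⟨rfl, rfl⟩)
      · exact absurd (hiff.1 hxz ▸ hyψ) hψf
    · have hxz : x ≠ z := fun e => hφf (e ▸ hxφ)
      have hyz : y ≠ z := fun e => hxz (hiff.2 e)
      rcases mem_fv_subst1_var hy with ⟨e, -⟩ | ⟨hyq, hyψ⟩
      · exact absurd e hyz
      · simpa [hxz, hyz] using hst x hxφ y hyψ (.inr ⟨hxp, hyq, hxy⟩)

theorem LStructure.evalT_eq_of_termAlpha (M : LStructure) {Γ : List (ℕ × ℕ)} {t u : LTerm}
    {r s : ℕ → M.U} (h : TermAlpha Γ t u) (hrs : ∀ x y, VarCorr Γ x y → r x = s y) :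
    M.evalT r t = M.evalT s u := by
  induction t generalizing u with
  | var n =>
    cases u <;> simp only [TermAlpha] at h
    exact hrs _ _ h
  | zero =>
    cases u <;> simp only [TermAlpha] at h
    rfl
  | succ t ih =>
    cases u <;> simp only [TermAlpha] at h
    simp only [evalT, ih h]
  | add t₁ t₂ ih₁ ih₂ =>
    cases u <;> simp only [TermAlpha] at h
    simp only [evalT, ih₁ h.1, ih₂ h.2]
  | mul t₁ t₂ ih₁ ih₂ =>
    cases u <;> simp only [TermAlpha] at h
    simp only [evalT, ih₁ h.1, ih₂ h.2]

theorem IsLStructure.sat_iff_of_formulaAlpha {M : LStructure} (hM : IsLStructure M)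
    {Γ : List (ℕ × ℕ)} {φ ψ : LFormula} {s t : ℕ → M.U} (h : FormulaAlpha Γ φ ψ)
    (hst : ∀ x y, VarCorr Γ x y → s x = t y) : M.Sat s φ ↔ M.Sat t ψ := by
  induction φ generalizing Γ ψ s t with
  | eq a b =>
    cases ψ <;> simp only [FormulaAlpha] at h
    simp only [LStructure.Sat, M.evalT_eq_of_termAlpha h.1 hst, M.evalT_eq_of_termAlpha h.2 hst]
  | falsum =>
    cases ψ <;> simp only [FormulaAlpha] at h
    rfl
  | imp a b iha ihb =>
    cases ψ <;> simp only [FormulaAlpha] at h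
    simp only [LStructure.Sat, iha h.1 hst, ihb h.2 hst]
  | all x a ih =>
    cases ψ <;> simp only [FormulaAlpha] at h
    simp only [LStructure.Sat]
    refine forall_congr' fun u => ih h ?_
    rintro v w (⟨rfl, rfl⟩ | ⟨hv, hw, hvw⟩)
    · simp
    · simpa [hv, hw] using hst v w hvw
  | K a ih =>
    cases ψ <;> simp only [FormulaAlpha] at h
    exact hM.satK_iff_of_formulaAlpha h fun x _ y _ hxy => hst x y hxy

theorem AlphaVariant.consequence_iff {φ ψ : LFormula} (h : AlphaVariant φ ψ)
    (T : Set LFormula) : Consequence T φ ↔ Consequence T ψ :=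
  forall_congr' fun _ => forall_congr' fun hM => forall_congr' fun _ =>
    forall_congr' fun s => hM.sat_iff_of_formulaAlpha h fun _ _ hxy => congrArg s hxy

theorem fv_numeral (n : ℕ) : (numeral n).fv = ∅ := by
  induction n with
  | zero => rfl
  | succ n ih => exact ih

theorem termAlpha_numeral (Γ : List (ℕ × ℕ)) (n : ℕ) :
    TermAlpha Γ (numeral n) (numeral n) := by
  induction n with
  | zero => trivial
  | succ n ih => exact ih

theorem AlphaVariant.instNum {φ ψ : LFormula} (h : AlphaVariant φ ψ) (s : ℕ → ℕ) :
    AlphaVariant (instNum s φ) (instNum s ψ) := by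
  refine FormulaAlpha.subst h ?_ (by simp [fv_numeral]) (by simp [fv_numeral])
  rintro x y rfl
  exact termAlpha_numeral _ _

theorem instNum_subst1_var {φ : LFormula} {x y : ℕ} (h : SubstitutableVar y x φ)
    (s : ℕ → ℕ) :
    instNum s (subst1 x (LTerm.var y) φ) = instNum (Function.update s x (s y)) φ := by
  unfold instNum
  rw [subst_subst1_var h]
  refine LFormula.subst_congr fun z _ => ?_
  by_cases hz : z = x
  · simp [hz]
  · simp [hz]

/-- For any set Σ of 𝓛-sentences, the data (universe ℕ, standard
interpretations of 0, S, +, ·, and the rule `K φ` is satisfied at `s` iff Σ ⊨ φ^s)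
really constitutes an 𝓛-structure `M_Σ`: it satisfies (a) irrelevance of assignments
to non-free variables, (b) invariance under alphabetic variants, (c) weak substitution. -/
theorem MSigma_isLStructure (T : Set LFormula) (hsent : ∀ σ ∈ T, σ.fv = ∅) :
    IsLStructure (MSigma T) := by
  refine ⟨fun φ s t hst => ?_, fun φ ψ s h => (h.instNum s).consequence_iff T,
    fun φ x y s h => ?_⟩
  · have e : instNum s φ = instNum t φ :=
      LFormula.subst_congr fun x hx => congrArg numeral (hst x hx)
    exact iff_of_eq (congrArg (Consequence T) e)
  · exact iff_of_eq (congrArg (Consequence T) (instNum_subst1_var h s))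
end

section
/- For any set Σ of 𝓛-sentences, the structure M_Σ satisfies all the axioms of Peano arithmetic for 𝓛: the usual axioms for successor, addition, and multiplication, and the universal closure of φ(x|0) → (∀x(φ → φ(x|S(x)))) → ∀x φ for every 𝓛-formula φ. -/
theorem LTerm.subst_congr_s10 {σ τ : ℕ → LTerm} {t : LTerm} (h : ∀ z ∈ t.fv, σ z = τ z) :
    t.subst σ = t.subst τ := by
  induction t <;> simp_all [LTerm.subst, LTerm.fv]

theorem LStructure.evalT_congr (M : LStructure) {s r : ℕ → M.U} {t : LTerm}
    (h : ∀ z ∈ t.fv, s z = r z) : M.evalT s t = M.evalT r t := by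
  induction t <;> simp_all [LStructure.evalT, LTerm.fv]

/-- The action of a substitution below a quantifier binding `x` preserves the property that every
variable is sent to a term in at most that variable. -/
theorem fv_subset_of_bind {σ : ℕ → LTerm} (hσ : ∀ z, (σ z).fv ⊆ {z}) (x z : ℕ) :
    (if z = x then LTerm.var x else σ z).fv ⊆ {z} := by
  split_ifs with h
  · simp [h, LTerm.fv]
  · exact hσ z

/-- Substitutions compose when the first one sends every variable to a term in at most that
variable, so that no variable is captured. -/
theorem LFormula.subst_subst (φ : LFormula) {σ : ℕ → LTerm} (hσ : ∀ z, (σ z).fv ⊆ {z})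
    (τ : ℕ → LTerm) : (φ.subst σ).subst τ = φ.subst fun z => (σ z).subst τ := by
  have term (t : LTerm) (σ τ : ℕ → LTerm) :
      (t.subst σ).subst τ = t.subst fun z => (σ z).subst τ := by
    induction t <;> simp_all [LTerm.subst]
  induction φ generalizing σ τ with
  | eq t u => simp [LFormula.subst, term]
  | falsum => rfl
  | imp a b iha ihb => simp [LFormula.subst, iha hσ, ihb hσ]
  | K a ih => simp [LFormula.subst, ih hσ]
  | all x a ih =>
    simp only [LFormula.subst, ih (fv_subset_of_bind hσ x)]
    congr 2
    funext z
    split_ifs with h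
    · simp [LTerm.subst]
    · refine LTerm.subst_congr_s10 fun w hw => if_neg ?_
      rwa [Finset.mem_singleton.1 (hσ z hw)]

/-- The substitution lemma in `M_Σ`, for substitutions that capture no variable and whose terms
become numerals once numerals are substituted for their variables. -/
theorem MSigma_sat_subst (T : Set LFormula) (φ : LFormula) {σ : ℕ → LTerm}
    (hσ : ∀ z, (σ z).fv ⊆ {z})
    (hnum : ∀ (s : ℕ → ℕ) (z : ℕ),
      (σ z).subst (fun w => numeral (s w)) = numeral ((MSigma T).evalT s (σ z)))
    (s : ℕ → ℕ) :
    (MSigma T).Sat s (φ.subst σ) ↔ (MSigma T).Sat (fun z => (MSigma T).evalT s (σ z)) φ := by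
  have term (t : LTerm) (σ : ℕ → LTerm) (s : ℕ → ℕ) : (MSigma T).evalT s (t.subst σ) =
      (MSigma T).evalT (fun z => (MSigma T).evalT s (σ z)) t := by
    induction t <;> simp_all [LTerm.subst, LStructure.evalT]
  induction φ generalizing σ s with
  | eq t u => simp only [LFormula.subst, LStructure.Sat, term]
  | falsum => rfl
  | imp a b iha ihb =>
    simp only [LFormula.subst, LStructure.Sat, iha hσ hnum s, ihb hσ hnum s]
  | K a ih =>
    have h : instNum s (a.subst σ) = instNum (fun z => (MSigma T).evalT s (σ z)) a := by
      simp only [instNum, LFormula.subst_subst a hσ, hnum]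
    exact iff_of_eq (congrArg (Consequence T) h)
  | all x a ih =>
    have hσ' := fv_subset_of_bind hσ x
    have hnum' (s : ℕ → ℕ) (z : ℕ) :
        (if z = x then LTerm.var x else σ z).subst (fun w => numeral (s w)) =
          numeral ((MSigma T).evalT s (if z = x then LTerm.var x else σ z)) := by
      split_ifs
      · rfl
      · exact hnum s z
    simp only [LFormula.subst, LStructure.Sat]
    refine forall_congr' fun u => (ih hσ' hnum' (Function.update s x u)).trans ?_
    refine iff_of_eq (congrArg (fun r => (MSigma T).Sat r a) (funext fun z => ?_))
    by_cases h : z = x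
    · rw [if_pos h, h, Function.update_self]
      exact Function.update_self x u s
    · rw [if_neg h, Function.update_of_ne h]
      refine (MSigma T).evalT_congr fun w hw => Function.update_of_ne ?_ _ _
      rwa [Finset.mem_singleton.1 (hσ z hw)]

theorem MSigma_sat_subst1 (T : Set LFormula) (φ : LFormula) (x : ℕ) {t : LTerm}
    (ht : t.fv ⊆ {x})
    (hnum : ∀ s : ℕ → ℕ, t.subst (fun w => numeral (s w)) = numeral ((MSigma T).evalT s t))
    (s : ℕ → ℕ) :
    (MSigma T).Sat s (subst1 x t φ) ↔
      (MSigma T).Sat (Function.update s x ((MSigma T).evalT s t)) φ := by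
  rw [subst1, MSigma_sat_subst T φ]
  · refine iff_of_eq (congrArg (fun r => (MSigma T).Sat r φ) (funext fun z => ?_))
    by_cases h : z = x
    · rw [if_pos h, h]
      exact (Function.update_self x _ s).symm
    · rw [if_neg h]
      exact (Function.update_of_ne h _ s).symm
  · intro z
    split_ifs with h
    · rwa [h]
    · simp [LTerm.fv]
  · intro s z
    split_ifs
    · exact hnum s
    · rfl

theorem LStructure.Models.uclose {M : LStructure} {φ : LFormula} (h : M.Models φ) :
    M.Models (uclose φ) := by
  unfold _root_.uclose
  induction φ.fv.sort (· ≤ ·) with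
  | nil => exact h
  | cons x L ih => exact fun s u => ih (Function.update s x u)

/-- For any set Σ of 𝓛-sentences, the structure M_Σ satisfies all the
axioms of Peano arithmetic for 𝓛 (including the induction schema for all 𝓛-formulas). -/
theorem MSigma_satisfies_PA (T : Set LFormula) (hsent : ∀ σ ∈ T, σ.fv = ∅) :
    ∀ χ : LFormula, PAax χ → (MSigma T).Models χ := by
  intro χ hχ
  cases hχ with
  | succ_ne_zero => exact fun s u => Nat.succ_ne_zero _
  | succ_inj => exact fun s u v => Nat.succ.inj
  | add_zero => exact fun s u => Nat.add_zero _
  | add_succ => exact fun s u v => Nat.add_succ _ _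
  | mul_zero => exact fun s u => Nat.mul_zero _
  | mul_succ => exact fun s u v => Nat.mul_succ _ _
  | ind φ x =>
    refine LStructure.Models.uclose fun s hzero hsucc u => ?_
    induction u using Nat.rec with
    | zero => exact (MSigma_sat_subst1 T φ x (by simp [LTerm.fv]) (fun _ => rfl) s).1 hzero
    | succ n ih =>
      have h := (MSigma_sat_subst1 T φ x (t := .succ (.var x)) (by simp [LTerm.fv])
        (fun _ => rfl) _).1 (hsucc n ih)
      have hupdate (r : ℕ → ℕ) : Function.update (Function.update r x n) x
          (Function.update r x n x + 1) = Function.update r x (n + 1) := by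
        rw [Function.update_self, Function.update_idem]
      exact (congrArg (fun r => (MSigma T).Sat r φ) (hupdate s)).mp h
end
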